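/- Fix a > 0 and T₀ > 0, write z' = z + 1/a, let β(t,x,y,z) = (a/T₀)·(z', 0, 0, t) with β² := Q(β) > 0 on the right Rindler wedge RRW = {z + 1/a > |t|}, u = β/√(β²), α² = −a²/T₀², and f(x) = 1/(12·β²(x)). Then on the RRW: −(1/6)·(∑_{μ,ν} u^μ u^ν ∂_μ∂_ν f − □f) = α²/(12(β²)²), where □ = ∂_t² − ∂_x² − ∂_y² − ∂_z². Consequently, adding this correction to the canonical energy density ρ = π²/(30(β²)²) − α²/(12(β²)²) gives the improved energy density ρ_IMP = π²/(30(β²)²), which depends only on β². -/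

import Mathlib

open Real MeasureTheory Filter Topology

noncomputable section

/-- Diagonal of the Minkowski metric diag(1,-1,-1,-1). -/
def ηd : Fin 4 → ℝ := ![1, -1, -1, -1]

/-- Minkowski quadratic form Q(v) = (v⁰)² − (v¹)² − (v²)² − (v³)². -/
def minkQ (v : Fin 4 → ℝ) : ℝ := ∑ μ, ηd μ * v μ * v μ

/-- Minkowski bilinear form η(v,w). -/
def minkB (v w : Fin 4 → ℝ) : ℝ := ∑ μ, ηd μ * v μ * w μ

/-- Covariant (lowered) components v_μ = η_{μν} v^ν. -/
def lo (v : Fin 4 → ℝ) (μ : Fin 4) : ℝ := ηd μ * v μ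

/-- Partial derivative ∂_μ of a scalar function on ℝ⁴. -/
def pd (μ : Fin 4) (f : (Fin 4 → ℝ) → ℝ) (x : Fin 4 → ℝ) : ℝ :=
  fderiv ℝ f x (Pi.single μ 1)

/-- Four-temperature field β(t,x,y,z) = (a/T₀)(z+1/a, 0, 0, t), with x = (t,x,y,z). -/
def betaF (a T₀ : ℝ) (x : Fin 4 → ℝ) : Fin 4 → ℝ :=
  fun μ => (a / T₀) * ![x 3 + 1 / a, 0, 0, x 0] μ

/-- The right Rindler wedge {z + 1/a > |t|}. -/
def RRW (a : ℝ) : Set (Fin 4 → ℝ) := {x | |x 0| < x 3 + 1 / a}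

/-- Flow velocity u = β/√(Q(β)). -/
def uF (a T₀ : ℝ) (x : Fin 4 → ℝ) : Fin 4 → ℝ :=
  fun μ => betaF a T₀ x μ / Real.sqrt (minkQ (betaF a T₀ x))

/-- Four-acceleration A^μ = u^ν ∂_ν u^μ. -/
def accF (a T₀ : ℝ) (x : Fin 4 → ℝ) : Fin 4 → ℝ :=
  fun μ => ∑ ν, uF a T₀ x ν * pd ν (fun y => uF a T₀ y μ) x

/-- Thermal acceleration α = √(Q(β))·A = A/T. -/
def alphaF (a T₀ : ℝ) (x : Fin 4 → ℝ) : Fin 4 → ℝ :=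
  fun μ => Real.sqrt (minkQ (betaF a T₀ x)) * accF a T₀ x μ

/-- The flat d'Alembertian □ = ∂_t² − ∂_x² − ∂_y² − ∂_z². -/
def dAlembert (f : (Fin 4 → ℝ) → ℝ) (x : Fin 4 → ℝ) : ℝ :=
  ∑ μ, ηd μ * pd μ (fun y => pd μ f y) x

/-- The squared Lorentz distance `(z + b)² − t²` from the edge of the wedge. -/
def wedgeSq (b : ℝ) (x : Fin 4 → ℝ) : ℝ := (x 3 + b) ^ 2 - x 0 ^ 2

/-- The components of the gradient of `wedgeSq`. -/
def wedgeGrad (b : ℝ) (μ : Fin 4) (x : Fin 4 → ℝ) : ℝ := ![-2 * x 0, 0, 0, 2 * (x 3 + b)] μ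

theorem wedgeSq_pos {a : ℝ} {x : Fin 4 → ℝ} (hx : x ∈ RRW a) : 0 < wedgeSq (1 / a) x :=
  sub_pos.2 (sq_lt_sq' (neg_lt_of_abs_lt hx) (lt_of_abs_lt hx))

theorem minkQ_betaF (a T₀ : ℝ) (x : Fin 4 → ℝ) :
    minkQ (betaF a T₀ x) = (a / T₀) ^ 2 * wedgeSq (1 / a) x := by
  simp [minkQ, betaF, ηd, wedgeSq, Fin.sum_univ_four]
  ring

theorem isOpen_RRW (a : ℝ) : IsOpen (RRW a) :=
  isOpen_lt (by fun_prop) (by fun_prop)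

theorem HasFDerivAt.pd_eq {f : (Fin 4 → ℝ) → ℝ} {f' : (Fin 4 → ℝ) →L[ℝ] ℝ} {x : Fin 4 → ℝ}
    (h : HasFDerivAt f f' x) (μ : Fin 4) : pd μ f x = f' (Pi.single μ 1) := by
  rw [pd, h.fderiv]

theorem differentiable_wedgeSq (b : ℝ) : Differentiable ℝ (wedgeSq b) := by
  unfold wedgeSq
  fun_prop

theorem differentiable_wedgeGrad (b : ℝ) (μ : Fin 4) : Differentiable ℝ (wedgeGrad b μ) := by
  unfold wedgeGrad
  fin_cases μ <;> simp <;> fun_prop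

theorem hasFDerivAt_coord (i : Fin 4) (x : Fin 4 → ℝ) :
    HasFDerivAt (fun y : Fin 4 → ℝ => y i) (ContinuousLinearMap.proj (R := ℝ) i) x :=
  hasFDerivAt_apply i x

theorem pd_wedgeSq (b : ℝ) (μ : Fin 4) (x : Fin 4 → ℝ) :
    pd μ (wedgeSq b) x = wedgeGrad b μ x := by
  have h : HasFDerivAt (wedgeSq b) _ x :=
    (((hasFDerivAt_coord 3 x).add_const b).pow 2).sub ((hasFDerivAt_coord 0 x).pow 2)
  rw [h.pd_eq]
  fin_cases μ <;> simp [wedgeGrad, mul_add]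

theorem pd_wedgeGrad (b : ℝ) (μ ν : Fin 4) (x : Fin 4 → ℝ) :
    pd μ (wedgeGrad b ν) x = if μ = ν then ![-2, 0, 0, 2] μ else 0 := by
  have h₀ := (hasFDerivAt_coord 0 x).const_mul (-2)
  have h₃ := ((hasFDerivAt_coord 3 x).add_const b).const_mul 2
  have hc := hasFDerivAt_const (𝕜 := ℝ) (0 : ℝ) x
  fin_cases ν
  · refine (HasFDerivAt.pd_eq (f := wedgeGrad b 0) h₀ μ).trans ?_
    fin_cases μ <;> simp
  · refine (HasFDerivAt.pd_eq (f := wedgeGrad b 1) hc μ).trans ?_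
    fin_cases μ <;> simp
  · refine (HasFDerivAt.pd_eq (f := wedgeGrad b 2) hc μ).trans ?_
    fin_cases μ <;> simp
  · refine (HasFDerivAt.pd_eq (f := wedgeGrad b 3) h₃ μ).trans ?_
    fin_cases μ <;> simp

theorem pd_const_mul_inv {s : (Fin 4 → ℝ) → ℝ} {x : Fin 4 → ℝ} (hs : DifferentiableAt ℝ s x)
    (h0 : s x ≠ 0) (c : ℝ) (μ : Fin 4) :
    pd μ (fun y => c * (s y)⁻¹) x = -c * pd μ s x / s x ^ 2 := by
  have h := ((hasDerivAt_inv h0).comp_hasFDerivAt x hs.hasFDerivAt).const_mul c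
  refine (HasFDerivAt.pd_eq h μ).trans ?_
  simp [pd]
  ring

theorem pd_const_mul_div_sq {g s : (Fin 4 → ℝ) → ℝ} {x : Fin 4 → ℝ}
    (hg : DifferentiableAt ℝ g x) (hs : DifferentiableAt ℝ s x)
    (h0 : s x ≠ 0) (c : ℝ) (μ : Fin 4) :
    pd μ (fun y => c * g y / s y ^ 2) x =
      c * (pd μ g x / s x ^ 2 - 2 * g x * pd μ s x / s x ^ 3) := by
  have hinv := (hasDerivAt_inv (pow_ne_zero 2 h0)).comp_hasFDerivAt x (hs.hasFDerivAt.pow 2)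
  have h := (hg.hasFDerivAt.const_mul c).mul hinv
  refine (HasFDerivAt.pd_eq (f := fun y => c * g y / s y ^ 2) h μ).trans ?_
  simp [pd]
  field_simp
  ring

theorem pd_congr {f g : (Fin 4 → ℝ) → ℝ} {x : Fin 4 → ℝ} (h : f =ᶠ[𝓝 x] g) (μ : Fin 4) :
    pd μ f x = pd μ g x := by
  rw [pd, pd, h.fderiv_eq]

theorem pd_pd_const_mul_inv_wedgeSq {a : ℝ} {x : Fin 4 → ℝ} (hx : x ∈ RRW a) (c : ℝ)
    (μ ν : Fin 4) :
    pd μ (fun y => pd ν (fun z => c * (wedgeSq (1 / a) z)⁻¹) y) x =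
      -c * ((if μ = ν then ![-2, 0, 0, 2] μ else 0) / wedgeSq (1 / a) x ^ 2 -
        2 * wedgeGrad (1 / a) ν x * wedgeGrad (1 / a) μ x / wedgeSq (1 / a) x ^ 3) := by
  have h : (fun y => pd ν (fun z => c * (wedgeSq (1 / a) z)⁻¹) y) =ᶠ[𝓝 x]
      fun y => -c * wedgeGrad (1 / a) ν y / wedgeSq (1 / a) y ^ 2 := by
    filter_upwards [(isOpen_RRW a).mem_nhds hx] with y hy
    rw [pd_const_mul_inv (differentiable_wedgeSq _ y) (wedgeSq_pos hy).ne', pd_wedgeSq]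
  rw [pd_congr h, pd_const_mul_div_sq (differentiable_wedgeGrad _ ν x)
    (differentiable_wedgeSq _ x) (wedgeSq_pos hx).ne', pd_wedgeGrad, pd_wedgeSq]

/-- On the right Rindler wedge, with f = 1/(12β²) and α² = −a²/T₀²:
−(1/6)(u^μu^ν∂_μ∂_νf − □f) = α²/(12(β²)²); consequently adding this improvement
correction to the canonical energy density ρ = π²/(30(β²)²) − α²/(12(β²)²)
yields the improved energy density ρ_IMP = π²/(30(β²)²), depending only on β². -/
theorem improvement_term_energy_density
    (a T₀ : ℝ) (ha : 0 < a) (hT₀ : 0 < T₀) :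
    ∀ x ∈ RRW a,
      -(1 / 6) *
        ((∑ μ, ∑ ν, uF a T₀ x μ * uF a T₀ x ν *
            pd μ (fun y => pd ν (fun z => 1 / (12 * minkQ (betaF a T₀ z))) y) x) -
          dAlembert (fun y => 1 / (12 * minkQ (betaF a T₀ y))) x) =
        (-(a ^ 2 / T₀ ^ 2)) / (12 * (minkQ (betaF a T₀ x)) ^ 2) ∧
      (Real.pi ^ 2 / (30 * (minkQ (betaF a T₀ x)) ^ 2) -
          (-(a ^ 2 / T₀ ^ 2)) / (12 * (minkQ (betaF a T₀ x)) ^ 2)) +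
        (-(a ^ 2 / T₀ ^ 2)) / (12 * (minkQ (betaF a T₀ x)) ^ 2) =
        Real.pi ^ 2 / (30 * (minkQ (betaF a T₀ x)) ^ 2) := by
  intro x hx
  refine ⟨?_, by ring⟩
  have hs := wedgeSq_pos hx
  have hk : 0 < a / T₀ := div_pos ha hT₀
  have hQ : 0 < minkQ (betaF a T₀ x) := by
    rw [minkQ_betaF]
    positivity
  have hf : (fun y => 1 / (12 * minkQ (betaF a T₀ y))) =
      fun y => (1 / (12 * (a / T₀) ^ 2)) * (wedgeSq (1 / a) y)⁻¹ := by
    funext y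
    rw [minkQ_betaF, ← mul_assoc, ← div_div, div_eq_mul_inv _ (wedgeSq _ y)]
  have hu (μ ν : Fin 4) : uF a T₀ x μ * uF a T₀ x ν =
      ![x 3 + 1 / a, 0, 0, x 0] μ * ![x 3 + 1 / a, 0, 0, x 0] ν / wedgeSq (1 / a) x := by
    rw [uF, uF, div_mul_div_comm, Real.mul_self_sqrt hQ.le, minkQ_betaF, betaF, betaF]
    field_simp
  simp only [dAlembert, hf, hu, pd_pd_const_mul_inv_wedgeSq hx]
  rw [minkQ_betaF, ← div_pow]
  generalize a / T₀ = k at hk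
  simp [Fin.sum_univ_four, wedgeGrad, ηd]
  have hs' : wedgeSq a⁻¹ x = (x 3 + a⁻¹) ^ 2 - x 0 ^ 2 := rfl
  rw [one_div] at hs
  generalize wedgeSq a⁻¹ x = s at hs hs'
  generalize x 3 + a⁻¹ = p at hs'
  generalize x 0 = t at hs'
  have hp : p ^ 2 = s + t ^ 2 := by linarith
  field_simp
  ring_nf
  simp only [hp]
  ring
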